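/- arXiv:2209.04849 — 8 statements merged into one kernel-verified Lean document; each statement's English description precedes it below -/
import Mathlib

section
/- Let (X, 𝒜, μ) be a measure space and define d(A,B) := μ(A ∪ B) − min(μ(A), μ(B)) for measurable sets of finite measure. Then d satisfies the ∇-inequality for unions: for all measurable sets A, B, C, D of finite measure, d(A ∪ B, C ∪ D) ≤ d(A,C) + d(B,D). -/
open MeasureTheory ENNReal

theorem aux_union {X : Type*} [MeasurableSpace X] (μ : Measure X) (A C : Set X)
    (hA : MeasurableSet A) (fA : μ A < ∞) (fC : μ C < ∞) :
    (μ (A ∪ C)).toReal = (μ A).toReal + (μ (C \ A)).toReal := by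
  rw [← Set.union_diff_self, measure_union' Set.disjoint_sdiff_right hA,
    ENNReal.toReal_add fA.ne ((measure_mono Set.diff_subset).trans_lt fC).ne]

theorem aux_diff {X : Type*} [MeasurableSpace X] (μ : Measure X) (A B C D : Set X)
    (fC : μ C < ∞) (fD : μ D < ∞) :
    (μ ((C ∪ D) \ (A ∪ B))).toReal ≤ (μ (C \ A)).toReal + (μ (D \ B)).toReal := by
  have h1 := ((measure_mono (Set.diff_subset (s := C) (t := A))).trans_lt fC).ne
  have h2 := ((measure_mono (Set.diff_subset (s := D) (t := B))).trans_lt fD).ne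
  rw [← ENNReal.toReal_add h1 h2]
  refine ENNReal.toReal_mono (ENNReal.add_ne_top.2 ⟨h1, h2⟩) ?_
  refine (measure_mono ?_).trans (measure_union_le _ _)
  rintro x ⟨h | h, h'⟩
  · exact Or.inl ⟨h, fun k => h' (Or.inl k)⟩
  · exact Or.inr ⟨h, fun k => h' (Or.inr k)⟩

/-- `d(A,B) := μ(A ∪ B) − min(μ(A), μ(B))` satisfies the
∇-inequality for unions: `d(A ∪ B, C ∪ D) ≤ d(A,C) + d(B,D)`. -/
theorem stmt_3 {X : Type*} [MeasurableSpace X] (μ : Measure X)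
    (d : Set X → Set X → ℝ)
    (hd : ∀ A B : Set X,
      d A B = (μ (A ∪ B)).toReal - min (μ A).toReal (μ B).toReal) :
    ∀ A B C D : Set X, MeasurableSet A → MeasurableSet B → MeasurableSet C →
      MeasurableSet D → μ A < ∞ → μ B < ∞ → μ C < ∞ → μ D < ∞ →
      d (A ∪ B) (C ∪ D) ≤ d A C + d B D := by
  intro A B C D hA hB hC hD fA fB fC fD
  have fAB := measure_union_lt_top fA fB
  have fCD := measure_union_lt_top fC fD
  have a1 := aux_union μ A C hA fA fC
  have a2 := aux_union μ C A hC fC fA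
  have b1 := aux_union μ B D hB fB fD
  have b2 := aux_union μ D B hD fD fB
  have c1 := aux_union μ (A ∪ B) (C ∪ D) (hA.union hB) fAB fCD
  have c2 := aux_union μ (C ∪ D) (A ∪ B) (hC.union hD) fCD fAB
  rw [Set.union_comm] at a2 b2 c2
  have e1 := aux_diff μ A B C D fC fD
  have e2 := aux_diff μ C D A B fA fB
  rw [hd, hd, hd]
  have m1 := min_le_left (μ A).toReal (μ C).toReal
  have m2 := min_le_right (μ A).toReal (μ C).toReal
  have m3 := min_le_left (μ B).toReal (μ D).toReal
  have m4 := min_le_right (μ B).toReal (μ D).toReal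
  rcases min_choice (μ (A ∪ B)).toReal (μ (C ∪ D)).toReal with h | h <;> rw [h] <;> linarith
end

section
/- Let (S, ∇, ε) be an abelian idempotent monoid, let ℓ : S → ℝ be any function, and define σ(x,y) := 2·ℓ(x ∇ y) − ℓ(x) − ℓ(y). If σ satisfies the triangle inequality σ(x,z) ≤ σ(x,y) + σ(y,z) for all x, y, z ∈ S, then ℓ is monotonically increasing, i.e. ℓ(x) ≤ ℓ(x ∇ y) for all x, y ∈ S. Moreover, if additionally ℓ(ε) ≥ 0 then ℓ is nonnegative and subadditive (ℓ(x ∇ y) ≤ ℓ(x) + ℓ(y) for all x, y ∈ S), and if ℓ(ε) = 0 then ℓ is a length function. -/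
/-- if `σ` satisfies the triangle inequality then `ℓ` is monotonically
increasing; moreover if `ℓ(ε) ≥ 0` then `ℓ` is nonnegative and subadditive, and if
`ℓ(ε) = 0` then `ℓ` is a length function. -/
theorem stmt_6 {S : Type*} [CommMonoid S] (idem : ∀ x : S, x * x = x)
    (ℓ : S → ℝ)
    (σ : S → S → ℝ)
    (hσ : ∀ x y : S, σ x y = 2 * ℓ (x * y) - ℓ x - ℓ y)
    (htri : ∀ x y z : S, σ x z ≤ σ x y + σ y z) :
    (∀ x y : S, ℓ x ≤ ℓ (x * y)) ∧
    (0 ≤ ℓ 1 →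
      (∀ x : S, 0 ≤ ℓ x) ∧ (∀ x y : S, ℓ (x * y) ≤ ℓ x + ℓ y)) ∧
    (ℓ 1 = 0 →
      ℓ 1 = 0 ∧ (∀ x y : S, ℓ (x * y) ≤ ℓ x + ℓ y) ∧
        (∀ x y : S, ℓ x ≤ ℓ (x * y))) := by
  have mono : ∀ x y : S, ℓ x ≤ ℓ (x * y) := by
    intro x y
    have h := htri x (x * y) x
    have e1 : x * (x * y) = x * y := by rw [← mul_assoc, idem]
    have e2 : x * y * x = x * y := by rw [mul_comm, e1]
    rw [hσ, hσ, hσ, idem, e1, e2] at h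
    linarith
  have sub : ∀ x y : S, ℓ (x * y) ≤ ℓ x + ℓ y - ℓ 1 := by
    intro x y
    have h := htri x 1 y
    rw [hσ, hσ, hσ, mul_one, one_mul] at h
    linarith
  refine ⟨mono, fun h => ⟨fun x => ?_, fun x y => ?_⟩, fun h => ⟨h, fun x y => ?_, mono⟩⟩
  · have := mono 1 x
    rw [one_mul] at this
    linarith
  · linarith [sub x y]
  · linarith [sub x y]
end

section
/- Let (S, ∇, ε) be an abelian idempotent monoid with ℓ : S → ℝ, define σ(x,y) := 2·ℓ(x ∇ y) − ℓ(x) − ℓ(y) and δ_y(x) := ℓ(x) − ℓ(x ∇ y), and order S by a ≤ b iff a ∇ b = b. If δ is increasing (for all y, a ≤ x implies δ_y(a) ≤ δ_y(x)) and ℓ is monotone (ℓ(x) ≤ ℓ(x ∇ y) for all x, y), then σ satisfies the triangle inequality σ(x,z) ≤ σ(x,y) + σ(y,z) for all x, y, z ∈ S. -/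
/-- if `δ` is increasing and `ℓ` monotone, then `σ` satisfies the
triangle inequality. -/
theorem stmt_13 {S : Type*} [CommMonoid S] (idem : ∀ x : S, x * x = x)
    (ℓ : S → ℝ)
    (σ : S → S → ℝ) (δ : S → S → ℝ)
    (hσ : ∀ x y : S, σ x y = 2 * ℓ (x * y) - ℓ x - ℓ y)
    (hδ : ∀ y x : S, δ y x = ℓ x - ℓ (x * y))
    (hδinc : ∀ y a x : S, a * x = x → δ y a ≤ δ y x)
    (hmono : ∀ x y : S, ℓ x ≤ ℓ (x * y)) :
    ∀ x y z : S, σ x z ≤ σ x y + σ y z := by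
  intro x y z
  have h1 := hδinc z y (y * x) (by rw [← mul_assoc, idem])
  rw [hδ, hδ] at h1
  have h2 := hmono (x * z) y
  have e : x * z * y = y * x * z := by
    rw [mul_comm (x * z) y, mul_assoc]
  rw [e] at h2
  rw [mul_comm y x] at h1 h2
  rw [hσ, hσ, hσ]
  linarith
end

section
/- Let (S, ∇, ε) be an abelian idempotent monoid with ℓ : S → ℝ, define σ(x,y) := 2·ℓ(x ∇ y) − ℓ(x) − ℓ(y) and δ_y(x) := ℓ(x) − ℓ(x ∇ y), and order S by a ≤ b iff a ∇ b = b. If σ satisfies the triangle inequality σ(x,z) ≤ σ(x,y) + σ(y,z) for all x, y, z ∈ S, then δ is increasing: for all y ∈ S and all a, x ∈ S with a ≤ x, δ_y(a) ≤ δ_y(x). -/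
/-- if `σ` satisfies the triangle inequality then `δ` is increasing. -/
theorem stmt_14 {S : Type*} [CommMonoid S] (idem : ∀ x : S, x * x = x)
    (ℓ : S → ℝ)
    (σ : S → S → ℝ) (δ : S → S → ℝ)
    (hσ : ∀ x y : S, σ x y = 2 * ℓ (x * y) - ℓ x - ℓ y)
    (hδ : ∀ y x : S, δ y x = ℓ x - ℓ (x * y))
    (htri : ∀ x y z : S, σ x z ≤ σ x y + σ y z) :
    ∀ y a x : S, a * x = x → δ y a ≤ δ y x := by
  intro y a x h
  have h1 : x * a = x := by rw [mul_comm, h]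
  have h2 : x * (a * y) = x * y := by rw [← mul_assoc, h1]
  have h3 : a * (a * y) = a * y := by rw [← mul_assoc, idem]
  have t := htri x a (a * y)
  rw [hσ, hσ, hσ, h1, h2, h3] at t
  rw [hδ, hδ]
  linarith
end

section
/- Let (S, ∇, ε) be an abelian idempotent monoid with ℓ : S → ℝ, define σ(x,y) := 2·ℓ(x ∇ y) − ℓ(x) − ℓ(y) and δ_y(x) := ℓ(x) − ℓ(x ∇ y), and order S by a ≤ b iff a ∇ b = b. If δ is increasing (for all y, a ≤ x implies δ_y(a) ≤ δ_y(x)), then σ satisfies the ∇-inequality: σ(x ∇ a, y ∇ b) ≤ σ(x,y) + σ(a,b) for all x, y, a, b ∈ S. -/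
/-- if `δ` is increasing then `σ` satisfies the ∇-inequality. -/
theorem stmt_15 {S : Type*} [CommMonoid S] (idem : ∀ x : S, x * x = x)
    (ℓ : S → ℝ)
    (σ : S → S → ℝ) (δ : S → S → ℝ)
    (hσ : ∀ x y : S, σ x y = 2 * ℓ (x * y) - ℓ x - ℓ y)
    (hδ : ∀ y x : S, δ y x = ℓ x - ℓ (x * y))
    (hδinc : ∀ y a x : S, a * x = x → δ y a ≤ δ y x) :
    ∀ x y a b : S, σ (x * a) (y * b) ≤ σ x y + σ a b := by
  have key : ∀ u v w : S, ℓ (u * v * w) - ℓ (u * v) ≤ ℓ (u * w) - ℓ u := by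
    intro u v w
    have h := hδinc w u (u * v) (by rw [← mul_assoc, idem])
    rw [hδ, hδ] at h
    linarith
  intro x y a b
  rw [hσ, hσ, hσ]
  have h1 := key x a y
  have h2 := key a (x * y) b
  have h3 := key y b x
  have h4 := key b (x * y) a
  have e1 : a * (x * y) = x * a * y := by ac_rfl
  have e2 : x * a * y * b = x * a * (y * b) := by ac_rfl
  have e3 : b * (x * y) = y * b * x := by ac_rfl
  have e4 : y * b * x * a = x * a * (y * b) := by ac_rfl
  rw [e1, e2] at h2
  rw [e3, e4] at h4
  rw [mul_comm y x] at h3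
  rw [mul_comm b a] at h4
  linarith
end

section
/- Let (S, ∇, ε) be an abelian idempotent monoid with ℓ : S → ℝ monotone (ℓ(x) ≤ ℓ(x ∇ y) for all x, y), define d(x,y) := ℓ(x ∇ y) − min(ℓ(x), ℓ(y)), δ_y(x) := ℓ(x) − ℓ(x ∇ y), and order S by a ≤ b iff a ∇ b = b. If d satisfies the very weak ∇-inequality (d(x ∇ z, y ∇ z) ≤ d(x,y) for all z and all x ≤ y), then δ is increasing: for all y ∈ S and all a, x ∈ S with a ≤ x, δ_y(a) ≤ δ_y(x). -/
/-- if `ℓ` is monotone and `d` satisfies the very weak ∇-inequality,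
then `δ` is increasing. -/
theorem stmt_16 {S : Type*} [CommMonoid S] (idem : ∀ x : S, x * x = x)
    (ℓ : S → ℝ)
    (hmono : ∀ x y : S, ℓ x ≤ ℓ (x * y))
    (d : S → S → ℝ) (δ : S → S → ℝ)
    (hd : ∀ x y : S, d x y = ℓ (x * y) - min (ℓ x) (ℓ y))
    (hδ : ∀ y x : S, δ y x = ℓ x - ℓ (x * y))
    (hvw : ∀ x y z : S, x * y = y → d (x * z) (y * z) ≤ d x y) :
    ∀ y a x : S, a * x = x → δ y a ≤ δ y x := by
  intro y a x h
  have h1 := hvw a x y h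
  have e : a * y * (x * y) = x * y := by
    rw [mul_mul_mul_comm, h, idem]
  have m1 : ℓ a ≤ ℓ x := by
    have := hmono a x
    rwa [h] at this
  have m2 : ℓ (a * y) ≤ ℓ (x * y) := by
    have := hmono (a * y) (x * y)
    rwa [e] at this
  rw [hd, hd, e, h, min_eq_left m1, min_eq_left m2] at h1
  rw [hδ, hδ]
  linarith
end

section
/- Let (S, ∇, ε) be an abelian idempotent monoid with a length function ℓ (in particular ℓ is monotonically increasing), define d(x,y) := ℓ(x ∇ y) − min(ℓ(x), ℓ(y)), σ(x,y) := 2·ℓ(x ∇ y) − ℓ(x) − ℓ(y), δ_y(x) := ℓ(x) − ℓ(x ∇ y), ζ(x ∩ y) := ℓ(x) + ℓ(y) − ℓ(x ∇ y), and order S by a ≤ b iff a ∇ b = b. Then the following six conditions are equivalent: (a) d satisfies the very weak ∇-inequality (d(x ∇ z, y ∇ z) ≤ d(x,y) for all z and all x ≤ y); (b) σ satisfies the very weak ∇-inequality; (c) δ is increasing (for all y, a ≤ x implies δ_y(a) ≤ δ_y(x)); (d) ζ is increasing (a ≤ x and b ≤ y imply ζ(a ∩ b) ≤ ζ(x ∩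 y)); (e) σ satisfies the triangle inequality; (f) σ satisfies the ∇-inequality (σ(x ∇ a, y ∇ b) ≤ σ(x,y) + σ(a,b) for all x, y, a, b). Moreover, each of these conditions implies that d satisfies the triangle inequality, and conversely the ∇-inequality for d (d(x ∇ a, y ∇ b) ≤ d(x,a) + d(y,b) for all x, y, a, b) implies all of them. -/
/-- for a length function `ℓ`, the conditions (a)–(f) are equivalent;
each of them implies the triangle inequality for `d`, and the ∇-inequality for `d`
implies all of them. -/
theorem stmt_18 {S : Type*} [CommMonoid S] (idem : ∀ x : S, x * x = x)
    (ℓ : S → ℝ) (hε : ℓ 1 = 0)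
    (hsub : ∀ x y : S, ℓ (x * y) ≤ ℓ x + ℓ y)
    (hmono : ∀ x y : S, ℓ x ≤ ℓ (x * y))
    (d σ : S → S → ℝ) (δ : S → S → ℝ) (ζ : S → S → ℝ)
    (hd : ∀ x y : S, d x y = ℓ (x * y) - min (ℓ x) (ℓ y))
    (hσ : ∀ x y : S, σ x y = 2 * ℓ (x * y) - ℓ x - ℓ y)
    (hδ : ∀ y x : S, δ y x = ℓ x - ℓ (x * y))
    (hζ : ∀ x y : S, ζ x y = ℓ x + ℓ y - ℓ (x * y)) :
    -- (a) ↔ (b)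
    ((∀ x y z : S, x * y = y → d (x * z) (y * z) ≤ d x y) ↔
      (∀ x y z : S, x * y = y → σ (x * z) (y * z) ≤ σ x y)) ∧
    -- (b) ↔ (c)
    ((∀ x y z : S, x * y = y → σ (x * z) (y * z) ≤ σ x y) ↔
      (∀ y a x : S, a * x = x → δ y a ≤ δ y x)) ∧
    -- (c) ↔ (d)
    ((∀ y a x : S, a * x = x → δ y a ≤ δ y x) ↔
      (∀ a b x y : S, a * x = x → b * y = y → ζ a b ≤ ζ x y)) ∧
    -- (d) ↔ (e)
    ((∀ a b x y : S, a * x = x → b * y = y → ζ a b ≤ ζ x y) ↔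
      (∀ x y z : S, σ x z ≤ σ x y + σ y z)) ∧
    -- (e) ↔ (f)
    ((∀ x y z : S, σ x z ≤ σ x y + σ y z) ↔
      (∀ x y a b : S, σ (x * a) (y * b) ≤ σ x y + σ a b)) ∧
    -- each condition implies the triangle inequality for d
    ((∀ x y z : S, x * y = y → d (x * z) (y * z) ≤ d x y) →
      (∀ x y z : S, d x z ≤ d x y + d y z)) ∧
    -- the ∇-inequality for d implies the above conditions
    ((∀ x y a b : S, d (x * y) (a * b) ≤ d x a + d y b) →
      (∀ x y z : S, x * y = y → d (x * z) (y * z) ≤ d x y)) := by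
  have hzz : ∀ z, d z z = 0 := by intro z; rw [hd, idem, min_self, sub_self]
  have hσz : ∀ z, σ z z = 0 := by intro z; rw [hσ, idem]; ring
  have hle : ∀ x y : S, x * y = y → ℓ x ≤ ℓ y := by
    intro x y h
    have := hmono x y
    rwa [h] at this
  have hmul : ∀ x y z : S, x * y = y → (x * z) * (y * z) = y * z := by
    intro x y z h
    rw [mul_mul_mul_comm, h, idem]
  have dle : ∀ x y : S, x * y = y → d x y = ℓ y - ℓ x := by
    intro x y h
    rw [hd, h, min_eq_left (hle x y h)]
  have sle : ∀ x y : S, x * y = y → σ x y = ℓ y - ℓ x := by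
    intro x y h
    rw [hσ, h]; ring
  have hA : (∀ x y z : S, x * y = y → d (x * z) (y * z) ≤ d x y) ↔
      (∀ x y z : S, x * y = y → ℓ (y * z) - ℓ (x * z) ≤ ℓ y - ℓ x) := by
    refine forall_congr' fun x => forall_congr' fun y => forall_congr' fun z =>
      forall_congr' fun h => ?_
    rw [dle _ _ h, dle _ _ (hmul x y z h)]
  have hB : (∀ x y z : S, x * y = y → σ (x * z) (y * z) ≤ σ x y) ↔
      (∀ x y z : S, x * y = y → ℓ (y * z) - ℓ (x * z) ≤ ℓ y - ℓ x) := by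
    refine forall_congr' fun x => forall_congr' fun y => forall_congr' fun z =>
      forall_congr' fun h => ?_
    rw [sle _ _ h, sle _ _ (hmul x y z h)]
  have hC : (∀ y a x : S, a * x = x → δ y a ≤ δ y x) ↔
      (∀ x y z : S, x * y = y → ℓ (y * z) - ℓ (x * z) ≤ ℓ y - ℓ x) := by
    constructor
    · intro H x y z h
      have := H z x y h
      rw [hδ, hδ] at this
      linarith
    · intro H y a x h
      have := H a x y h
      rw [hδ, hδ]
      linarith
  have hM : (∀ x y z : S, x * y = y → ℓ (y * z) - ℓ (x * z) ≤ ℓ y - ℓ x) →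
      ∀ x y z : S, ℓ (x * y * z) - ℓ (x * z) ≤ ℓ (x * y) - ℓ x := by
    intro H x y z
    exact H x (x * y) z (by rw [← mul_assoc, idem])
  have hD : (∀ a b x y : S, a * x = x → b * y = y → ζ a b ≤ ζ x y) ↔
      (∀ x y z : S, x * y = y → ℓ (y * z) - ℓ (x * z) ≤ ℓ y - ℓ x) := by
    constructor
    · intro H x y z h
      have := H x z y z h (idem z)
      rw [hζ, hζ] at this
      linarith
    · intro H a b x y h1 h2
      have e1 := H a x b h1
      have e2 := H b y x h2
      rw [mul_comm y x, mul_comm b x] at e2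
      rw [hζ, hζ]
      linarith
  have hT : (∀ x y z : S, x * y = y → ℓ (y * z) - ℓ (x * z) ≤ ℓ y - ℓ x) →
      ∀ x y z : S, ℓ (x * z) ≤ ℓ (x * y) + ℓ (y * z) - ℓ y := by
    intro H x y z
    have e1 := hM H y x z
    have e2 := hmono (x * z) y
    rw [show x * z * y = y * x * z by rw [mul_comm, mul_assoc]] at e2
    rw [mul_comm x y]
    linarith
  have hE : (∀ x y z : S, σ x z ≤ σ x y + σ y z) ↔
      (∀ x y z : S, x * y = y → ℓ (y * z) - ℓ (x * z) ≤ ℓ y - ℓ x) := by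
    constructor
    · intro H x y z h
      have := H y x z
      simp only [hσ] at this
      rw [mul_comm y x, h] at this
      linarith
    · intro H x y z
      have := hT H x y z
      simp only [hσ]
      linarith
  have hF : (∀ x y a b : S, σ (x * a) (y * b) ≤ σ x y + σ a b) ↔
      (∀ x y z : S, x * y = y → ℓ (y * z) - ℓ (x * z) ≤ ℓ y - ℓ x) := by
    constructor
    · intro H
      refine hB.1 fun x y z _ => ?_
      have := H x y z z
      rw [hσz] at this
      linarith
    · intro H
      have key : ∀ x y a b : S, ℓ (x * a * (y * b)) - ℓ (x * a) ≤
          ℓ (x * y) - ℓ x + (ℓ (a * b) - ℓ a) := by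
        intro x y a b
        have e1 := hM H x y (a * b)
        have e2 := hM H a b x
        rw [mul_mul_mul_comm]
        rw [mul_comm (a * b) x, mul_comm a x] at e2
        linarith
      intro x y a b
      have e1 := key x y a b
      have e2 := key y x b a
      rw [mul_comm (y * b), mul_comm y x, mul_comm b a] at e2
      simp only [hσ]
      linarith
  refine ⟨hA.trans hB.symm, hB.trans hC.symm, hC.trans hD.symm, hD.trans hE.symm,
    hE.trans hF.symm, ?_, ?_⟩
  · intro H x y z
    have := hT (hA.1 H) x y z
    simp only [hd]
    have h1 := min_le_left (ℓ x) (ℓ y)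
    have h2 := min_le_right (ℓ x) (ℓ y)
    have h3 := min_le_left (ℓ y) (ℓ z)
    have h4 := min_le_right (ℓ y) (ℓ z)
    rcases min_choice (ℓ x) (ℓ z) with h | h <;> rw [h] <;> linarith
  · intro H x y z _
    have := H x z y z
    rw [hzz] at this
    linarith
end

section
/- Let (S, ∇, ε) be an abelian idempotent monoid and let d : S × S → ℝ be a nonnegative symmetric function with d(x,x) = 0 that satisfies both the triangle inequality (d(x,z) ≤ d(x,y) + d(y,z)) and the ∇-inequality (d(x ∇ y, a ∇ b) ≤ d(x,a) + d(y,b)). Define ℓ(x) := d(x, ε) and ℓ̄(x) := inf over z ∈ S of ℓ(x ∇ z). Then for all x, y ∈ S: ℓ(x ∇ y) − min(ℓ(x), ℓ(y)) ≤ d(x,y), and also ℓ̄(x ∇ y) − min(ℓ̄(x), ℓ̄(y)) ≤ d(x,y). -/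
/-- for a pseudometric `d` satisfying the ∇-inequality, the distance
functions induced by `ℓ(x) := d(x,ε)` and by `ℓ̄(x) := ⨅_z ℓ(x ∇ z)` are dominated
by `d`. -/
theorem stmt_19 {S : Type*} [CommMonoid S] (idem : ∀ x : S, x * x = x)
    (d : S → S → ℝ)
    (hpos : ∀ x y : S, 0 ≤ d x y)
    (hsymm : ∀ x y : S, d x y = d y x)
    (hnil : ∀ x : S, d x x = 0)
    (htri : ∀ x y z : S, d x z ≤ d x y + d y z)
    (hnabla : ∀ x y a b : S, d (x * y) (a * b) ≤ d x a + d y b)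
    (ℓ ℓbar : S → ℝ)
    (hℓ : ∀ x : S, ℓ x = d x 1)
    (hℓbar : ∀ x : S, ℓbar x = ⨅ z : S, ℓ (x * z)) :
    ∀ x y : S,
      ℓ (x * y) - min (ℓ x) (ℓ y) ≤ d x y ∧
      ℓbar (x * y) - min (ℓbar x) (ℓbar y) ≤ d x y := by
  have key : ∀ x y z : S, ℓ (x * y * z) ≤ d x y + ℓ (x * z) := by
    intro x y z
    rw [hℓ, hℓ]
    have h1 := htri (x * y * z) (x * z) 1
    have h2 := hnabla (x * y) z x z
    have h3 := hnabla x y x x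
    rw [idem] at h3
    have h4 := hnil x
    have h5 := hnil z
    have h6 := hsymm x y
    linarith
  have keyb : ∀ x y : S, ℓbar (x * y) ≤ d x y + ℓbar x := by
    intro x y
    have hb : BddBelow (Set.range fun z : S => ℓ (x * y * z)) := by
      refine ⟨0, ?_⟩
      rintro _ ⟨z, rfl⟩
      simp only [hℓ]
      exact hpos _ _
    have h : ℓbar (x * y) - d x y ≤ ⨅ z : S, ℓ (x * z) := by
      refine le_ciInf fun z => ?_
      have h1 := ciInf_le hb z
      rw [← hℓbar] at h1
      have h2 := key x y z
      linarith
    rw [← hℓbar] at h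
    linarith
  intro x y
  have a1 := key x y 1
  have a2 := key y x 1
  have b1 := keyb x y
  have b2 := keyb y x
  simp only [mul_one] at a1 a2
  rw [mul_comm y x, hsymm y x] at a2 b2
  constructor
  · rcases min_choice (ℓ x) (ℓ y) with h | h <;> rw [h] <;> linarith
  · rcases min_choice (ℓbar x) (ℓbar y) with h | h <;> rw [h] <;> linarith
end
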